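/- Let a, b be integers with a > 2 or b > 2, and set k = max(a,b). Then H^{m,n}(G_A(a,b)) = 0 whenever m > 0, and also whenever m = 0 and n < k; and for m = 0 and n ≥ k, H^{0,n}(G_A(a,b)) is a ℂ-vector space of dimension binom(2, a+b−n) (in particular zero unless 0 ≤ a+b−n ≤ 2). -/

import Mathlib

/- Setup: `Ex = ⋀(ℂ⁴)` is the exterior algebra on generators `f 0, f 1, f 2, f 3`
(`f 0, f 1` the "plus" generators, `f 2, f 3` the "minus" generators); `lamPM k b`
is `Λ₊ᵏ∧Λ₋ᵇ` (zero for indices outside `{0,1,2}`).  `G_A = Ex ⊗ ℂ[x₁,x₂,y₁,y₂]`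
(variables `X 0, X 1 = x₁, x₂` and `X 2, X 3 = y₁, y₂`) with differential
`∇(ω⊗p) = (f₁∧ω)⊗∂ₓ₁∂ᵧ₁p + (f₂∧ω)⊗∂ₓ₂∂ᵧ₁p + (f₃∧ω)⊗∂ₓ₁∂ᵧ₂p + (f₄∧ω)⊗∂ₓ₂∂ᵧ₂p`.
`GA a b m n` is the bigraded piece `G_A(a,b)^{m,n}` spanned by the
`ω ⊗ q·y₁ʳy₂ˢ` with `ω ∈ Λ₊^{a−r}∧Λ₋^{b−s}`, `q` homogeneous of degree `m` in
`x₁,x₂`, and `r+s = n`. -/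

set_option synthInstance.maxHeartbeats 1000000
set_option maxHeartbeats 1000000

noncomputable section

open scoped TensorProduct

abbrev Ex : Type := ExteriorAlgebra ℂ (Fin 4 → ℂ)

def f (i : Fin 4) : Ex := ExteriorAlgebra.ι ℂ (Pi.single i 1)

/-- `Λ₊ᵏ∧Λ₋ᵇ` for integer indices (zero when `k < 0` or `b < 0`). -/
def lamPM (k b : ℤ) : Submodule ℂ Ex :=
  Submodule.span ℂ {x | ∃ lp lm : List (Fin 2), (lp.length : ℤ) = k ∧ (lm.length : ℤ) = b ∧
    x = (lp.map (fun i : Fin 2 => f ⟨i.1, by have := i.2; omega⟩)).prod *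
        (lm.map (fun i : Fin 2 => f ⟨i.1 + 2, by have := i.2; omega⟩)).prod}

abbrev P4 : Type := MvPolynomial (Fin 4) ℂ

abbrev MEx : Type := Ex ⊗[ℂ] P4

instance : AddCommGroup MEx := inferInstance
instance : Module ℂ MEx := inferInstance

def pd (i : Fin 4) : P4 →ₗ[ℂ] P4 := (MvPolynomial.pderiv i).toLinearMap

/-- the inclusion of the `x`-variables -/
def xin : Fin 2 → Fin 4 := fun i => ⟨i.1, by have := i.2; omega⟩

/-- `∇(ω⊗p) = (f₁∧ω)⊗∂ₓ₁∂ᵧ₁p + (f₂∧ω)⊗∂ₓ₂∂ᵧ₁p + (f₃∧ω)⊗∂ₓ₁∂ᵧ₂p + (f₄∧ω)⊗∂ₓ₂∂ᵧ₂p` -/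
def nabla : MEx →ₗ[ℂ] MEx :=
  TensorProduct.map (LinearMap.mulLeft ℂ (f 0)) (pd 0 ∘ₗ pd 2) +
  TensorProduct.map (LinearMap.mulLeft ℂ (f 1)) (pd 1 ∘ₗ pd 2) +
  TensorProduct.map (LinearMap.mulLeft ℂ (f 2)) (pd 0 ∘ₗ pd 3) +
  TensorProduct.map (LinearMap.mulLeft ℂ (f 3)) (pd 1 ∘ₗ pd 3)

/-- The bigraded piece `G_A(a,b)^{m,n}`. -/
def GA (a b m n : ℤ) : Submodule ℂ MEx :=
  Submodule.span ℂ {z | ∃ (r s d : ℕ) (ω : Ex) (q : MvPolynomial (Fin 2) ℂ),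
    ω ∈ lamPM (a - r) (b - s) ∧ q.IsHomogeneous d ∧ (d : ℤ) = m ∧ ((r : ℤ) + s = n) ∧
    z = ω ⊗ₜ (MvPolynomial.rename xin q * MvPolynomial.X 2 ^ r * MvPolynomial.X 3 ^ s)}

/-- `binom(2, n)` for an integer `n`, interpreted as `0` when `n < 0`. -/
def zbinom (n : ℤ) : ℕ := if 0 ≤ n then Nat.choose 2 n.toNat else 0


abbrev sg (j : Fin 2) : Fin 2 → ℤ := Pi.single j 1

def fidx (j i : Fin 2) : Fin 4 := ⟨i.1 + 2 * j.1, by have := i.2; have := j.2; omega⟩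
def yv (j : Fin 2) : Fin 4 := ⟨j.1 + 2, by have := j.2; omega⟩

def FF (j i : Fin 2) : Ex := f (fidx j i)

def ct (j i : Fin 2) : Ex →ₗ[ℂ] Ex := CliffordAlgebra.contractLeft (LinearMap.proj (fidx j i))

def lam (d : Fin 2 → ℤ) : Submodule ℂ Ex := lamPM (d 0) (d 1)

lemma fidx_inj {j i j' i' : Fin 2} : fidx j i = fidx j' i' ↔ (j = j' ∧ i = i') := by
  revert j i j' i'; decide

lemma ct_FF_mul (j i j' i' : Fin 2) (x : Ex) :
    ct j i (FF j' i' * x) = (if j = j' ∧ i = i' then x else 0) - FF j' i' * ct j i x := by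
  unfold ct FF f
  refine (CliffordAlgebra.contractLeft_ι_mul _ _ _).trans ?_
  have : (LinearMap.proj (R := ℂ) (φ := fun _ : Fin 4 => ℂ) (fidx j i)) (Pi.single (fidx j' i') 1)
      = if j = j' ∧ i = i' then 1 else 0 := by
    simp only [LinearMap.proj_apply, Pi.single_apply, fidx_inj]
  rw [this]
  split_ifs <;> simp <;> rfl

lemma ct_one (j i : Fin 2) : ct j i 1 = 0 := CliffordAlgebra.contractLeft_one _ _

lemma FF_anti (j i j' i' : Fin 2) (x : Ex) :
    FF j i * (FF j' i' * x) = - (FF j' i' * (FF j i * x)) := by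
  have := ExteriorAlgebra.ι_add_mul_swap (R := ℂ) (M := Fin 4 → ℂ) (Pi.single (fidx j i) (1:ℂ)) (Pi.single (fidx j' i') (1:ℂ))
  rw [← mul_assoc, ← mul_assoc, ← neg_mul]
  congr 1
  exact eq_neg_of_add_eq_zero_left this

lemma FF_sq (j i : Fin 2) (x : Ex) : FF j i * (FF j i * x) = 0 := by
  rw [← mul_assoc]
  have := ExteriorAlgebra.ι_sq_zero (R := ℂ) (M := Fin 4 → ℂ) (Pi.single (fidx j i) (1:ℂ))
  change FF j i * FF j i = 0 at this
  rw [this, zero_mul]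

lemma lam_mul {d : Fin 2 → ℤ} {ω : Ex} (h : ω ∈ lam d) (j i : Fin 2) :
    FF j i * ω ∈ lam (d + sg j) := by
  unfold lam lamPM at h
  induction h using Submodule.span_induction with
  | zero => simp
  | add x y _ _ hx hy => rw [mul_add]; exact add_mem hx hy
  | smul c x _ hx => rw [mul_smul_comm]; exact Submodule.smul_mem _ _ hx
  | mem x hx =>
    obtain ⟨lp, lm, h1, h2, rfl⟩ := hx
    fin_cases j
    · refine Submodule.subset_span ⟨i :: lp, lm, ?_, ?_, ?_⟩
      · simp [h1]
      · simp [h2]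
      · simp only [List.map_cons, List.prod_cons, mul_assoc]; rfl
    · have key : ∀ lp : List (Fin 2), ∀ y : Ex, ∃ e : ℂ, FF 1 i * ((lp.map (fun i : Fin 2 => f ⟨i.1, by have := i.2; omega⟩)).prod * y)
          = e • ((lp.map (fun i : Fin 2 => f ⟨i.1, by have := i.2; omega⟩)).prod * (FF 1 i * y)) := by
        intro lp y
        induction lp with
        | nil => exact ⟨1, by simp⟩
        | cons k lp ih =>
          obtain ⟨e, he⟩ := ih
          refine ⟨-e, ?_⟩
          have := FF_anti 1 i 0 k ((lp.map (fun i : Fin 2 => f ⟨i.1, by have := i.2; omega⟩)).prod * y)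
          rw [he] at this
          simp only [List.map_cons, List.prod_cons, mul_assoc]
          refine this.trans ?_
          rw [neg_smul, mul_smul_comm]; rfl
      obtain ⟨e, he⟩ := key lp (lm.map (fun i : Fin 2 => f ⟨i.1 + 2, by have := i.2; omega⟩)).prod
      refine he ▸ Submodule.smul_mem _ _ (Submodule.subset_span ⟨lp, i :: lm, ?_, ?_, ?_⟩)
      · simp [h1]
      · simp [h2]
      · simp only [List.map_cons, List.prod_cons]; rfl

lemma lam_induction {P : (Fin 2 → ℤ) → Ex → Prop}
    (zero : ∀ d, P d 0) (add : ∀ d x y, P d x → P d y → P d (x + y))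
    (smul : ∀ d (c : ℂ) x, P d x → P d (c • x)) (one : P 0 1)
    (mul : ∀ d ω j i, ω ∈ lam d → P d ω → P (d + sg j) (FF j i * ω))
    {d : Fin 2 → ℤ} {ω : Ex} (h : ω ∈ lam d) : P d ω := by
  unfold lam lamPM at h
  induction h using Submodule.span_induction with
  | zero => exact zero _
  | add x y _ _ hx hy => exact add _ _ _ hx hy
  | smul c x _ hx => exact smul _ _ _ hx
  | mem x hx =>
    obtain ⟨lp, lm, h1, h2, rfl⟩ := hx
    suffices H : ∀ (lp lm : List (Fin 2)) (x : Ex), x = (lp.map (fun i : Fin 2 => f ⟨i.1, by have := i.2; omega⟩)).prod *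
        (lm.map (fun i : Fin 2 => f ⟨i.1 + 2, by have := i.2; omega⟩)).prod →
        x ∈ lam ![(lp.length : ℤ), lm.length] ∧ P ![(lp.length : ℤ), lm.length] x by
      have := (H lp lm _ rfl).2
      convert this using 1
      ext k; fin_cases k <;> simp [h1, h2]
    clear h1 h2
    intro lp
    induction lp with
    | nil =>
      intro lm
      induction lm with
      | nil =>
        rintro x rfl
        refine ⟨Submodule.subset_span ⟨[], [], by simp, by simp, rfl⟩, ?_⟩
        convert one using 1
        · ext k; fin_cases k <;> simp
        · simp
      | cons i lm ih =>
        rintro x rfl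
        obtain ⟨m1, m2⟩ := ih _ rfl
        have e1 : (![(([] : List (Fin 2)).length : ℤ), ((i :: lm).length : ℤ)] : Fin 2 → ℤ) = ![(([] : List (Fin 2)).length : ℤ), (lm.length : ℤ)] + sg 1 := by
          ext k; fin_cases k <;> simp
        have := mul _ _ 1 i m1 m2
        have h' := lam_mul m1 1 i
        rw [e1]
        simp only [List.map_nil, List.prod_nil, one_mul, List.map_cons, List.prod_cons] at *
        exact ⟨h', this⟩
    | cons i lp ih =>
      rintro lm x rfl
      obtain ⟨m1, m2⟩ := ih lm _ rfl
      have e1 : (![((i :: lp).length : ℤ), (lm.length : ℤ)] : Fin 2 → ℤ) = ![(lp.length : ℤ), (lm.length : ℤ)] + sg 0 := by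
        ext k; fin_cases k <;> simp
      have := mul _ _ 0 i m1 m2
      have h' := lam_mul m1 0 i
      rw [e1]
      simp only [List.map_cons, List.prod_cons, mul_assoc] at *
      exact ⟨h', this⟩

lemma lam_neg {d : Fin 2 → ℤ} {ω : Ex} (h : ω ∈ lam d) (c : Fin 2) (hc : d c < 0) : ω = 0 := by
  unfold lam lamPM at h
  induction h using Submodule.span_induction with
  | zero => rfl
  | add x y _ _ hx hy => rw [hx, hy, add_zero]
  | smul c x _ hx => rw [hx, smul_zero]
  | mem x hx =>
    obtain ⟨lp, lm, h1, h2, rfl⟩ := hx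
    exfalso
    fin_cases c <;> simp at hc <;> omega

lemma FFF (c i j k : Fin 2) (x : Ex) : FF c i * (FF c j * (FF c k * x)) = 0 := by
  have : i = j ∨ j = k ∨ i = k := by revert i j k; decide
  rcases this with rfl | rfl | rfl
  · exact FF_sq _ _ _
  · rw [FF_sq, mul_zero]
  · rw [FF_anti c j c i, mul_neg, FF_sq, neg_zero]

lemma lam_big {d : Fin 2 → ℤ} {ω : Ex} (h : ω ∈ lam d) (c : Fin 2) (hc : 3 ≤ d c) : ω = 0 := by
  have := lam_induction (P := fun d ω => (3 ≤ d c → ω = 0) ∧ (2 ≤ d c → ∀ i, FF c i * ω = 0) ∧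
    (1 ≤ d c → ∀ i j, FF c i * (FF c j * ω) = 0)) ?_ ?_ ?_ ?_ ?_ h
  · exact this.1 hc
  · intro d; simp
  · rintro d x y ⟨h1, h2, h3⟩ ⟨h1', h2', h3'⟩
    refine ⟨fun h => by rw [h1 h, h1' h, add_zero], fun h i => by rw [mul_add, h2 h, h2' h, add_zero], 
      fun h i j => by rw [mul_add, mul_add, h3 h, h3' h, add_zero]⟩
  · rintro d c x ⟨h1, h2, h3⟩ 
    refine ⟨fun h => by rw [h1 h, smul_zero], fun h i => by rw [mul_smul_comm, h2 h, smul_zero], 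
      fun h i j => by rw [mul_smul_comm, mul_smul_comm, h3 h, smul_zero]⟩
  · refine ⟨?_, ?_, ?_⟩ <;> intro h <;> simp at h
  · rintro d ω j i _ ⟨h1, h2, h3⟩
    by_cases hj : j = c
    · subst hj
      simp only [Pi.add_apply, Pi.single_eq_same]
      exact ⟨fun h => h2 (by omega) _, fun h k => h3 (by omega) _ _, fun h k l => FFF _ _ _ _ _⟩
    · have : (d + sg j) c = d c := by simp [Pi.single_apply, Ne.symm hj]
      simp only [this]
      refine ⟨fun h => by rw [h1 h, mul_zero], fun h k => by rw [FF_anti, h2 h, mul_zero, neg_zero], 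
        fun h k l => by rw [FF_anti c l, mul_neg, FF_anti c k, h3 h, mul_zero, neg_zero, neg_zero]⟩

lemma lam_ct {d : Fin 2 → ℤ} {ω : Ex} (h : ω ∈ lam d) (j i : Fin 2) :
    ct j i ω ∈ lam (d - sg j) := by
  refine lam_induction (P := fun d ω => ct j i ω ∈ lam (d - sg j)) ?_ ?_ ?_ ?_ ?_ h
  · intro d; simp
  · intro d x y hx hy; rw [map_add]; exact add_mem hx hy
  · intro d c x hx; rw [map_smul]; exact Submodule.smul_mem _ _ hx
  · rw [ct_one]; exact zero_mem _
  · intro d ω j' i' hω hi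
    rw [ct_FF_mul]
    refine sub_mem ?_ ?_
    · split_ifs with hh
      · rw [hh.1, add_sub_cancel_right]; exact hω
      · exact zero_mem _
    · have := lam_mul hi j' i'
      rwa [sub_add_eq_add_sub] at this

lemma lam_euler {d : Fin 2 → ℤ} {ω : Ex} (h : ω ∈ lam d) (c : Fin 2) :
    FF c 0 * ct c 0 ω + FF c 1 * ct c 1 ω = (d c : ℂ) • ω := by
  refine lam_induction (P := fun d ω => FF c 0 * ct c 0 ω + FF c 1 * ct c 1 ω = (d c : ℂ) • ω) ?_ ?_ ?_ ?_ ?_ h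
  · intro d; simp
  · intro d x y hx hy; rw [smul_add, ← hx, ← hy]; simp only [map_add, mul_add]; abel
  · intro d c x hx; rw [smul_comm, ← hx]; simp only [map_smul, mul_smul_comm, smul_add]
  · simp [ct_one]
  · intro d ω j i hω hi
    have e : FF j i * (FF c 0 * ct c 0 ω) + FF j i * (FF c 1 * ct c 1 ω) = (d c : ℂ) • (FF j i * ω) := by
      rw [← mul_add, hi, mul_smul_comm]
    simp only [ct_FF_mul, mul_sub]
    rw [FF_anti c 0 j i, FF_anti c 1 j i]
    have e2 : (((d + sg j) c : ℤ) : ℂ) • (FF j i * ω) = (d c : ℂ) • (FF j i * ω) + (if c = j then FF j i * ω else 0) := by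
      by_cases hj : c = j
      · subst hj; simp [add_smul]
      · simp [Pi.single_apply, hj]
    rw [e2, ← e]
    by_cases hj : c = j
    · subst hj
      fin_cases i <;> simp <;> abel
    · simp [hj]

open MvPolynomial in
def II (c : Fin 2) : P4 →ₗ[ℂ] P4 := (MvPolynomial.basisMonomials (Fin 4) ℂ).constr ℂ
  (fun e => monomial (e + Finsupp.single (yv c) 1) (1 / ((e (yv c) : ℂ) + 1)))

open MvPolynomial in
lemma II_monomial (c : Fin 2) (e : Fin 4 →₀ ℕ) (k : ℂ) :
    II c (monomial e k) = monomial (e + Finsupp.single (yv c) 1) (k / ((e (yv c) : ℂ) + 1)) := by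
  have h1 : II c (monomial e 1) = monomial (e + Finsupp.single (yv c) 1) (1 / ((e (yv c) : ℂ) + 1)) := by
    have := (MvPolynomial.basisMonomials (Fin 4) ℂ).constr_basis ℂ
      (fun e => monomial (e + Finsupp.single (yv c) 1) (1 / ((e (yv c) : ℂ) + 1))) e
    rw [MvPolynomial.coe_basisMonomials] at this
    exact this
  have h2 : (monomial e k : P4) = k • monomial e 1 := by rw [smul_monomial]; simp
  rw [h2, map_smul, h1, smul_monomial]
  congr 1
  simp [div_eq_mul_inv]

lemma pd_monomial (i : Fin 4) (e : Fin 4 →₀ ℕ) (k : ℂ) :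
    pd i (MvPolynomial.monomial e k) = MvPolynomial.monomial (e - Finsupp.single i 1) (k * e i) :=
  MvPolynomial.pderiv_monomial

lemma mono_congr {e e' : Fin 4 →₀ ℕ} {k k' : ℂ} (h : e = e') (h' : k = k') :
    (MvPolynomial.monomial e k : P4) = MvPolynomial.monomial e' k' := by rw [h, h']

lemma pd_comm (i j : Fin 4) (P : P4) : pd i (pd j P) = pd j (pd i P) := by
  induction P using MvPolynomial.induction_on' with
  | add p q hp hq => simp only [map_add, hp, hq]
  | monomial e k =>
    simp only [pd_monomial]
    by_cases h : i = j
    · rw [h]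
    · apply mono_congr
      · rw [tsub_right_comm]
      · have h' : j ≠ i := Ne.symm h
        simp [Finsupp.single_apply, h, h']; ring

lemma pd_II_self (c : Fin 2) (P : P4) : pd (yv c) (II c P) = P := by
  induction P using MvPolynomial.induction_on' with
  | add p q hp hq => simp only [map_add, hp, hq]
  | monomial e k =>
    rw [II_monomial, pd_monomial]
    have : (e (yv c) : ℂ) + 1 ≠ 0 := Nat.cast_add_one_ne_zero _
    apply mono_congr
    · simp
    · simp; field_simp

lemma pd_II_ne (c : Fin 2) (i : Fin 4) (hi : i ≠ yv c) (P : P4) : pd i (II c P) = II c (pd i P) := by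
  induction P using MvPolynomial.induction_on' with
  | add p q hp hq => simp only [map_add, hp, hq]
  | monomial e k =>
    simp only [II_monomial, pd_monomial]
    by_cases he : e i = 0
    · have h1 : (e + Finsupp.single (yv c) 1 : Fin 4 →₀ ℕ) i = 0 := by simp [Finsupp.single_apply, hi.symm, he]
      rw [h1, he]; simp
    · apply mono_congr
      · ext t
        simp only [Finsupp.coe_tsub, Finsupp.coe_add, Pi.sub_apply, Pi.add_apply, Finsupp.single_apply]
        by_cases h1 : i = t
        · subst h1; simp [hi.symm]
        · simp [h1]
      · simp [Finsupp.single_apply, hi, hi.symm]; ring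

lemma II_pd_self (c : Fin 2) (e : Fin 4 →₀ ℕ) (k : ℂ) (h : 1 ≤ e (yv c)) :
    II c (pd (yv c) (MvPolynomial.monomial e k)) = MvPolynomial.monomial e k := by
  have : (e (yv c) : ℂ) ≠ 0 := Nat.cast_ne_zero.mpr (by omega)
  rw [pd_monomial, II_monomial]
  apply mono_congr
  · ext t
    simp only [Finsupp.coe_tsub, Finsupp.coe_add, Pi.sub_apply, Pi.add_apply, Finsupp.single_apply]
    split_ifs with h1
    · subst h1; omega
    · simp
  · simp [Nat.cast_sub h]; field_simp

def mX (i : Fin 2) : P4 →ₗ[ℂ] P4 := LinearMap.mulLeft ℂ (MvPolynomial.X (xin i))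

lemma xin_ne_yv (i j : Fin 2) : xin i ≠ yv j := by revert i j; decide
lemma xin_ne {i j : Fin 2} (h : i ≠ j) : xin i ≠ xin j := by revert i j; decide
lemma yv_ne {i j : Fin 2} (h : i ≠ j) : yv i ≠ yv j := by revert i j; decide

lemma pd_mX_self (i : Fin 2) (P : P4) : pd (xin i) (mX i P) = P + mX i (pd (xin i) P) := by
  simp only [mX, pd, LinearMap.mulLeft_apply, Derivation.coeFn_coe,
    Derivation.leibniz, MvPolynomial.pderiv_X_self, smul_eq_mul]
  ring

lemma pd_mX_ne (i : Fin 2) (t : Fin 4) (h : xin i ≠ t) (P : P4) : pd t (mX i P) = mX i (pd t P) := by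
  simp only [mX, pd, LinearMap.mulLeft_apply, Derivation.coeFn_coe,
    Derivation.leibniz, MvPolynomial.pderiv_X_of_ne h, smul_eq_mul]
  ring

def hh (c : Fin 2) : MEx →ₗ[ℂ] MEx :=
  TensorProduct.map (ct c 0) (mX 0 ∘ₗ II c) + TensorProduct.map (ct c 1) (mX 1 ∘ₗ II c)

lemma hh_tmul (c : Fin 2) (ω : Ex) (P : P4) :
    hh c (ω ⊗ₜ P) = ct c 0 ω ⊗ₜ mX 0 (II c P) + ct c 1 ω ⊗ₜ mX 1 (II c P) := rfl

lemma nabla_tmul {c c' : Fin 2} (h : c ≠ c') (ω : Ex) (P : P4) :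
    nabla (ω ⊗ₜ P) = (FF c 0 * ω) ⊗ₜ pd (xin 0) (pd (yv c) P) + (FF c 1 * ω) ⊗ₜ pd (xin 1) (pd (yv c) P)
     + (FF c' 0 * ω) ⊗ₜ pd (xin 0) (pd (yv c') P) + (FF c' 1 * ω) ⊗ₜ pd (xin 1) (pd (yv c') P) := by
  have e : nabla (ω ⊗ₜ P) = (FF 0 0 * ω) ⊗ₜ pd (xin 0) (pd (yv 0) P) + (FF 0 1 * ω) ⊗ₜ pd (xin 1) (pd (yv 0) P)
     + (FF 1 0 * ω) ⊗ₜ pd (xin 0) (pd (yv 1) P) + (FF 1 1 * ω) ⊗ₜ pd (xin 1) (pd (yv 1) P) := rfl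
  rw [e]
  have : (c = 0 ∧ c' = 1) ∨ (c = 1 ∧ c' = 0) := by revert c c'; decide
  rcases this with ⟨rfl, rfl⟩ | ⟨rfl, rfl⟩
  · rfl
  · abel

lemma nabla_sq (z : MEx) : nabla (nabla z) = 0 := by
  induction z using TensorProduct.induction_on with
  | zero => simp
  | add x y hx hy => rw [map_add, map_add, hx, hy, add_zero]
  | tmul ω P =>
    have h01 : (0 : Fin 2) ≠ 1 := by decide
    rw [nabla_tmul h01]
    simp only [map_add, nabla_tmul h01, FF_sq, TensorProduct.zero_tmul]
    rw [FF_anti 0 1 0 0, FF_anti 1 0 0 0, FF_anti 1 1 0 0, FF_anti 1 0 0 1, FF_anti 1 1 0 1, FF_anti 1 1 1 0]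
    simp only [pd_comm (yv 0) (xin 0), pd_comm (yv 0) (xin 1), pd_comm (yv 1) (xin 0), pd_comm (yv 1) (xin 1),
      pd_comm (xin 1) (xin 0), pd_comm (yv 1) (yv 0), TensorProduct.neg_tmul]
    abel

lemma L_tmul {c c' : Fin 2} (h : c ≠ c') (ω : Ex) (P : P4)
    (H : ∀ i, II c (pd (xin i) (pd (yv c) P)) = pd (xin i) P) :
    nabla (hh c (ω ⊗ₜ P)) + hh c (nabla (ω ⊗ₜ P)) =
      ω ⊗ₜ (mX 0 (pd (xin 0) P) + mX 1 (pd (xin 1) P)) +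
      (FF c 0 * ct c 0 ω + FF c 1 * ct c 1 ω) ⊗ₜ P +
      ((FF c' 0 * ct c 0 ω) ⊗ₜ II c (pd (yv c') P) + (FF c' 1 * ct c 1 ω) ⊗ₜ II c (pd (yv c') P)) := by
  have h01 : (0 : Fin 2) ≠ 1 := by decide
  have h10 : (1 : Fin 2) ≠ 0 := by decide
  rw [hh_tmul, nabla_tmul h]
  simp only [map_add, nabla_tmul h, hh_tmul, H]
  simp only [pd_mX_ne _ _ (xin_ne_yv _ _), pd_II_self, pd_II_ne c _ (yv_ne h.symm), pd_mX_self,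
    pd_mX_ne _ _ (xin_ne h01), pd_mX_ne _ _ (xin_ne h10), pd_II_ne c _ (xin_ne_yv _ _), map_add,
    ct_FF_mul, h, h01, h10, TensorProduct.tmul_add, TensorProduct.add_tmul, TensorProduct.sub_tmul,
    and_true, and_false, false_and, if_true, if_false, true_and, TensorProduct.zero_tmul]
  abel

def dg (A : Fin 2 → ℤ) (e : Fin 4 →₀ ℕ) : Fin 2 → ℤ := fun j => A j - e (yv j)

def Fil (c : Fin 2) (p : ℤ) (A : Fin 2 → ℤ) (m n : ℤ) : Submodule ℂ MEx :=
  Submodule.span ℂ {z | ∃ (ω : Ex) (e : Fin 4 →₀ ℕ), ω ∈ lam (dg A e) ∧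
    ((e (xin 0) : ℤ) + e (xin 1) = m) ∧ ((e (yv 0) : ℤ) + e (yv 1) = n) ∧ dg A e c ≤ p ∧
    z = ω ⊗ₜ MvPolynomial.monomial e 1}

lemma mono_smul (e : Fin 4 →₀ ℕ) (k : ℂ) : (MvPolynomial.monomial e k : P4) = k • MvPolynomial.monomial e 1 := by
  rw [MvPolynomial.smul_monomial]; simp

lemma mem_Fil {c : Fin 2} {p : ℤ} {A : Fin 2 → ℤ} {m n : ℤ} {ω : Ex} {e : Fin 4 →₀ ℕ} {d : Fin 2 → ℤ}
    (h : ω ∈ lam d) (hd : d = dg A e)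
    (h1 : (e (xin 0) : ℤ) + e (xin 1) = m) (h2 : (e (yv 0) : ℤ) + e (yv 1) = n) (h3 : dg A e c ≤ p) (k : ℂ) :
    ω ⊗ₜ[ℂ] (MvPolynomial.monomial e k : P4) ∈ Fil c p A m n := by
  rw [mono_smul, TensorProduct.tmul_smul]
  exact Submodule.smul_mem _ _ (Submodule.subset_span ⟨ω, e, hd ▸ h, h1, h2, h3, rfl⟩)

lemma Fil_le_GA (c : Fin 2) (p : ℤ) (a b m n : ℤ) : Fil c p ![a, b] m n ≤ GA a b m n := by
  refine Submodule.span_le.2 ?_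
  rintro z ⟨ω, e, hω, h1, h2, h3, rfl⟩
  refine Submodule.subset_span ⟨e (yv 0), e (yv 1), e (xin 0) + e (xin 1), ω, 
    MvPolynomial.X 0 ^ e (xin 0) * MvPolynomial.X 1 ^ e (xin 1), hω, ?_, by push_cast; exact h1, h2, ?_⟩
  · exact (MvPolynomial.isHomogeneous_X_pow _ _).mul (MvPolynomial.isHomogeneous_X_pow _ _)
  · congr 1
    rw [MvPolynomial.monomial_eq, Finsupp.prod_fintype _ _ (by simp), Fin.prod_univ_four]
    simp only [map_one, one_mul, map_mul, map_pow, MvPolynomial.rename_X]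
    rfl

lemma GA_le_Fil (c : Fin 2) (a b m n : ℤ) : GA a b m n ≤ Fil c 2 ![a, b] m n := by
  refine Submodule.span_le.2 ?_
  rintro z ⟨r, s, d, ω, q, hω, hq, h1, h2, rfl⟩
  rw [SetLike.mem_coe]
  have hinj : Function.Injective xin := by decide
  rw [MvPolynomial.as_sum q]
  simp only [map_sum, Finset.sum_mul, TensorProduct.tmul_sum]
  refine Submodule.sum_mem _ fun t ht => ?_
  have hc := hq (MvPolynomial.mem_support_iff.1 ht)
  rw [MvPolynomial.rename_monomial, MvPolynomial.X_pow_eq_monomial, MvPolynomial.X_pow_eq_monomial,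
    MvPolynomial.monomial_mul, MvPolynomial.monomial_mul]
  set e : Fin 4 →₀ ℕ := Finsupp.mapDomain xin t + Finsupp.single 2 r + Finsupp.single 3 s with he
  have e0 : e (xin 0) = t 0 := by
    rw [he, Finsupp.add_apply, Finsupp.add_apply, Finsupp.mapDomain_apply hinj]; simp [xin]
  have e1 : e (xin 1) = t 1 := by
    rw [he, Finsupp.add_apply, Finsupp.add_apply, Finsupp.mapDomain_apply hinj]; simp [xin]
  have e2 : e (yv 0) = r := by
    rw [he, Finsupp.add_apply, Finsupp.add_apply, Finsupp.mapDomain_notin_range _ _ (by decide)]; simp [yv]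
  have e3 : e (yv 1) = s := by
    rw [he, Finsupp.add_apply, Finsupp.add_apply, Finsupp.mapDomain_notin_range _ _ (by decide)]; simp [yv]
  have hd : ![a - r, b - s] = dg ![a, b] e := by
    ext j; fin_cases j <;> simp [dg, e2, e3]
  have hω' : ω ∈ lam ![a - r, b - s] := hω
  by_cases hbig : dg ![a, b] e c ≤ 2
  · refine mem_Fil hω' hd ?_ (by rw [e2, e3]; exact h2) hbig _
    rw [e0, e1, ← h1, ← hc]
    simp [Finsupp.weight_apply, Finsupp.sum_fintype]
  · rw [lam_big hω' c (by rw [hd]; omega), TensorProduct.zero_tmul]; exact zero_mem _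

lemma mX_monomial (i : Fin 2) (e : Fin 4 →₀ ℕ) (k : ℂ) :
    mX i (MvPolynomial.monomial e k) = MvPolynomial.monomial (e + Finsupp.single (xin i) 1) k := by
  rw [mX, LinearMap.mulLeft_apply, mul_comm]
  rw [MvPolynomial.X, MvPolynomial.monomial_mul, mul_one]

lemma mX_pd (i : Fin 2) (e : Fin 4 →₀ ℕ) :
    mX i (pd (xin i) (MvPolynomial.monomial e 1)) = (e (xin i) : ℂ) • MvPolynomial.monomial e 1 := by
  rw [pd_monomial, mX_monomial, ← mono_smul]
  by_cases h : e (xin i) = 0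
  · simp [h]
  · apply mono_congr _ (one_mul _)
    ext t
    simp only [Finsupp.coe_tsub, Finsupp.coe_add, Pi.sub_apply, Pi.add_apply, Finsupp.single_apply]
    split_ifs with h1
    · subst h1; omega
    · simp

lemma hh_mem (c : Fin 2) {p : ℤ} {A : Fin 2 → ℤ} {m n : ℤ} {z : MEx} (hz : z ∈ Fil c p A m n) :
    hh c z ∈ Fil c p A (m + 1) (n + 1) := by
  induction hz using Submodule.span_induction with
  | zero => simp
  | add x y _ _ hx hy => rw [map_add]; exact add_mem hx hy
  | smul c x _ hx => rw [map_smul]; exact Submodule.smul_mem _ _ hx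
  | mem z hz =>
    obtain ⟨ω, e, hω, h1, h2, h3, rfl⟩ := hz
    rw [hh_tmul, II_monomial, mX_monomial, mX_monomial]
    have key : ∀ i, ct c i ω ⊗ₜ[ℂ] (MvPolynomial.monomial (e + Finsupp.single (yv c) 1 + Finsupp.single (xin i) 1) (1 / ((e (yv c) : ℂ) + 1)) : P4) ∈ Fil c p A (m + 1) (n + 1) := by
      intro i
      have hd : dg A e - sg c = dg A (e + Finsupp.single (yv c) 1 + Finsupp.single (xin i) 1) := by
        ext j; fin_cases j <;> fin_cases c <;> fin_cases i <;> simp [dg, yv, xin] <;> ring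
      refine mem_Fil (lam_ct hω c i) hd ?_ ?_ ?_ _
      · rw [← h1]; fin_cases c <;> fin_cases i <;> simp [yv, xin] <;> ring
      · rw [← h2]; fin_cases c <;> fin_cases i <;> simp [yv, xin] <;> ring
      · rw [← hd]; simp; omega
    exact add_mem (key 0) (key 1)

lemma L_step (c : Fin 2) {p : ℤ} {A : Fin 2 → ℤ} {m n : ℤ} (H : m = 0 ∨ p < A c)
    {z : MEx} (hz : z ∈ Fil c p A m n) :
    ((m + p : ℤ) : ℂ) • z - (nabla (hh c z) + hh c (nabla z)) ∈ Fil c (p - 1) A m n := by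
  induction hz using Submodule.span_induction with
  | zero => simp
  | add x y _ _ hx hy =>
    convert add_mem hx hy using 1
    simp only [map_add, smul_add]; abel
  | smul k x _ hx =>
    convert Submodule.smul_mem _ k hx using 1
    simp only [map_smul, smul_sub, smul_add]; rw [smul_comm]
  | mem z hz =>
    obtain ⟨ω, e, hω, h1, h2, h3, rfl⟩ := hz
    obtain ⟨c', hc'⟩ : ∃ c' : Fin 2, c ≠ c' := (by decide : ∀ c : Fin 2, ∃ c', c ≠ c') c
    rw [L_tmul hc' ω]
    · rw [lam_euler hω, mX_pd, mX_pd]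
      have key : ∀ i, (FF c' i * ct c i ω) ⊗ₜ[ℂ] II c (pd (yv c') (MvPolynomial.monomial e 1)) ∈ Fil c (p - 1) A m n := by
        intro i
        rw [pd_monomial, II_monomial]
        by_cases h0 : e (yv c') = 0
        · simp [h0]
        · have hv : ∀ t, (e - Finsupp.single (yv c') 1 + Finsupp.single (yv c) 1 : Fin 4 →₀ ℕ) t =
            e t - (if yv c' = t then 1 else 0) + (if yv c = t then 1 else 0) := by
            intro t; simp [Finsupp.single_apply]
          have hd : dg A e - sg c + sg c' = dg A (e - Finsupp.single (yv c') 1 + Finsupp.single (yv c) 1) := by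
            ext j
            simp only [dg, Pi.add_apply, Pi.sub_apply, hv]
            revert h0
            fin_cases j <;> fin_cases c <;> fin_cases c' <;> simp [yv] at hc' ⊢ <;> omega
          refine mem_Fil (lam_mul (lam_ct hω c i) c' i) hd ?_ ?_ ?_ _
          · rw [hv, hv, ← h1]; simp [(xin_ne_yv _ _).symm]
          · rw [hv, hv, ← h2]
            revert h0
            fin_cases c <;> fin_cases c' <;> simp [yv] at hc' ⊢ <;> omega
          · rw [← hd]; simp [hc'.symm, hc']; omega
      have e2 : ((m + p : ℤ) : ℂ) • (ω ⊗ₜ[ℂ] (MvPolynomial.monomial e 1 : P4)) - 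
          (ω ⊗ₜ[ℂ] ((e (xin 0) : ℂ) • MvPolynomial.monomial e 1 + (e (xin 1) : ℂ) • MvPolynomial.monomial e 1) +
          ((dg A e c : ℂ) • ω) ⊗ₜ[ℂ] (MvPolynomial.monomial e 1 : P4)) = ((p - dg A e c : ℤ) : ℂ) • (ω ⊗ₜ[ℂ] (MvPolynomial.monomial e 1 : P4)) := by
        rw [← h1, TensorProduct.tmul_add, TensorProduct.tmul_smul, TensorProduct.tmul_smul, ← TensorProduct.smul_tmul']
        push_cast
        module
      rw [← sub_sub, e2]
      refine sub_mem ?_ (add_mem (key 0) (key 1))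
      by_cases hp : dg A e c = p
      · simp [hp]
      · exact Submodule.smul_mem _ _ (mem_Fil hω rfl h1 h2 (by omega) _)
    · intro i
      rcases H with rfl | H
      · have : e (xin i) = 0 := by fin_cases i <;> simp <;> omega
        rw [pd_comm]
        simp [pd_monomial, this]
      · have : 1 ≤ e (yv c) := by unfold dg at h3; omega
        rw [← pd_II_ne c _ (xin_ne_yv _ _), II_pd_self _ _ _ this]

lemma Fil_neg (c : Fin 2) {p : ℤ} (hp : p < 0) (A : Fin 2 → ℤ) (m n : ℤ) : Fil c p A m n = ⊥ := by
  rw [eq_bot_iff]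
  refine Submodule.span_le.2 ?_
  rintro z ⟨ω, e, hω, h1, h2, h3, rfl⟩
  rw [lam_neg hω c (by omega)]; simp

lemma exact_pos (c : Fin 2) {a b m n : ℤ} (hA : 2 < ![a, b] c) (hm : 0 < m) :
    GA a b m n ⊓ LinearMap.ker nabla ≤ Submodule.map nabla (GA a b (m + 1) (n + 1)) := by
  have key : ∀ k : ℕ, k ≤ 3 → ∀ z ∈ Fil c ((k : ℤ) - 1) ![a, b] m n, nabla z = 0 →
      z ∈ Submodule.map nabla (GA a b (m + 1) (n + 1)) := by
    intro k
    induction k with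
    | zero => 
      intro _ z hz _
      rw [Fil_neg c (by simp)] at hz
      rw [(Submodule.mem_bot ℂ).1 hz]; exact zero_mem _
    | succ k ih =>
      intro hk z hz hz0
      have h1 := L_step c (Or.inr (by push_cast; omega)) hz
      have him : nabla (hh c z) ∈ Submodule.map nabla (GA a b (m + 1) (n + 1)) :=
        Submodule.mem_map_of_mem (Fil_le_GA _ _ _ _ _ _ (hh_mem c hz))
      rw [hz0, map_zero, add_zero] at h1
      have h2 := ih (by omega) _ (by convert h1 using 2; push_cast; ring) (by rw [map_sub, map_smul, nabla_sq, hz0]; simp)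
      have h3 := add_mem h2 him
      rw [sub_add_cancel] at h3
      exact (Submodule.smul_mem_iff _ (by rw [Int.cast_ne_zero]; push_cast; omega)).1 h3
  rintro z ⟨hz, hz0⟩
  exact key 3 le_rfl z (by simpa using GA_le_Fil c a b m n hz) hz0

lemma nabla_m0 {a b n : ℤ} {z : MEx} (hz : z ∈ GA a b 0 n) : nabla z = 0 := by
  have := GA_le_Fil 0 _ _ _ _ hz
  clear hz
  unfold Fil at this
  induction this using Submodule.span_induction with
  | zero => simp
  | add x y _ _ hx hy => rw [map_add, hx, hy, add_zero]
  | smul k x _ hx => rw [map_smul, hx, smul_zero]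
  | mem z hz =>
    obtain ⟨ω, e, hω, h1, h2, h3, rfl⟩ := hz
    have h01 : (0 : Fin 2) ≠ 1 := by decide
    have e0 : e (xin 0) = 0 := by omega
    have e1 : e (xin 1) = 0 := by omega
    rw [nabla_tmul h01]
    simp only [pd_comm (xin _) (yv _)]
    simp [pd_monomial, e0, e1]

lemma zero_red (c : Fin 2) {a b n : ℤ} {z : MEx} (hz : z ∈ GA a b 0 n) :
    z ∈ Submodule.map nabla (GA a b (0 + 1) (n + 1)) ⊔ Fil c 0 ![a, b] 0 n := by
  have key : ∀ k : ℕ, ∀ z ∈ Fil c k ![a, b] 0 n, 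
      z ∈ Submodule.map nabla (GA a b (0 + 1) (n + 1)) ⊔ Fil c 0 ![a, b] 0 n := by
    intro k
    induction k with
    | zero => 
      intro z hz 
      exact Submodule.mem_sup_right (by simpa using hz)
    | succ k ih =>
      intro z hz
      have hz0 := nabla_m0 (Fil_le_GA _ _ _ _ _ _ hz)
      have h1 := L_step c (Or.inl rfl) hz
      have him : nabla (hh c z) ∈ Submodule.map nabla (GA a b (0 + 1) (n + 1)) :=
        Submodule.mem_map_of_mem (Fil_le_GA _ _ _ _ _ _ (hh_mem c hz))
      rw [hz0, map_zero, add_zero] at h1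
      have h2 := ih _ (by convert h1 using 2; push_cast; ring)
      have h3 := add_mem h2 (Submodule.mem_sup_left him)
      rw [sub_add_cancel] at h3
      exact (Submodule.smul_mem_iff _ (by rw [Int.cast_ne_zero]; push_cast; omega)).1 h3
  exact key 2 z (by simpa using GA_le_Fil c a b 0 n hz)

lemma exact_zero (c : Fin 2) {a b n : ℤ} (hA : n < ![a, b] c) :
    GA a b 0 n ≤ Submodule.map nabla (GA a b (0 + 1) (n + 1)) := by
  intro z hz
  have := zero_red c hz
  have h0 : Fil c 0 ![a, b] 0 n = ⊥ := by
    rw [eq_bot_iff]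
    refine Submodule.span_le.2 ?_
    rintro z ⟨ω, e, hω, h1, h2, h3, rfl⟩
    exfalso
    unfold dg at h3
    fin_cases c <;> simp at * <;> omega
  rwa [h0, sup_bot_eq] at this

def lin4 : (Fin 4 → ℂ) →ₗ[ℂ] (Fin 4 → ℂ) := (Pi.basisFun ℂ (Fin 4)).constr ℂ
  ![-Pi.single 2 1, -Pi.single 3 1, Pi.single 2 1, Pi.single 3 1]

def theta : Ex →ₐ[ℂ] Ex := ExteriorAlgebra.map lin4

lemma theta_f (i : Fin 4) : theta (f i) = ExteriorAlgebra.ι ℂ ((![-Pi.single 2 1, -Pi.single 3 1, Pi.single 2 1, Pi.single 3 1] : Fin 4 → Fin 4 → ℂ) i) := by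
  unfold theta f
  rw [ExteriorAlgebra.map_apply_ι]
  congr 1
  have := (Pi.basisFun ℂ (Fin 4)).constr_basis ℂ (![-Pi.single 2 1, -Pi.single 3 1, Pi.single 2 1, Pi.single 3 1] : Fin 4 → Fin 4 → ℂ) i
  rw [Pi.basisFun_apply] at this
  exact this

lemma theta_F0 (i : Fin 2) : theta (FF 0 i) = - FF 1 i := by
  unfold FF; rw [theta_f]
  fin_cases i <;> simp [fidx, f]

lemma theta_F1 (i : Fin 2) : theta (FF 1 i) = FF 1 i := by
  unfold FF; rw [theta_f]
  fin_cases i <;> simp [fidx, f]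

lemma theta_mem {d : Fin 2 → ℤ} {ω : Ex} (h : ω ∈ lam d) : theta ω ∈ lam ![0, d 0 + d 1] := by
  refine lam_induction (P := fun d ω => theta ω ∈ lam ![0, d 0 + d 1]) ?_ ?_ ?_ ?_ ?_ h
  · intro d; simp
  · intro d x y hx hy; rw [map_add]; exact add_mem hx hy
  · intro d c x hx; rw [map_smul]; exact Submodule.smul_mem _ _ hx
  · rw [map_one]; exact Submodule.subset_span ⟨[], [], by simp, by simp, by simp⟩
  · intro d ω j i hω hi
    have h1 := lam_mul hi 1 i
    have e : (![0, (d + sg j) 0 + (d + sg j) 1] : Fin 2 → ℤ) = ![0, d 0 + d 1] + sg 1 := by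
      ext k; fin_cases k <;> fin_cases j <;> simp <;> ring
    rw [e, map_mul]
    fin_cases j
    · change theta (FF 0 i) * _ ∈ _
      rw [theta_F0, neg_mul]; exact neg_mem h1
    · change theta (FF 1 i) * _ ∈ _
      rw [theta_F1]; exact h1

lemma theta_id {d : Fin 2 → ℤ} {ω : Ex} (h : ω ∈ lam d) (hd : d 0 ≤ 0) : theta ω = ω := by
  refine lam_induction (P := fun d ω => d 0 ≤ 0 → theta ω = ω) ?_ ?_ ?_ ?_ ?_ h hd
  · intro d; simp
  · intro d x y hx hy h; rw [map_add, hx h, hy h]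
  · intro d c x hx h; rw [map_smul, hx h]
  · simp
  · intro d ω j i hω hi h
    fin_cases j
    · have : d 0 < 0 := by simp at h; omega
      rw [lam_neg hω 0 this]; simp
    · change theta (FF 1 i * ω) = FF 1 i * ω
      rw [map_mul, theta_F1, hi (by simpa using h)]

def ell : P4 →ₗ[ℂ] ℂ := (MvPolynomial.basisMonomials (Fin 4) ℂ).constr ℂ
  (fun e => ((e (yv 0)).factorial : ℂ) * ((e (yv 1)).factorial : ℂ))

lemma ell_monomial (e : Fin 4 →₀ ℕ) (k : ℂ) :
    ell (MvPolynomial.monomial e k) = k * (((e (yv 0)).factorial : ℂ) * ((e (yv 1)).factorial : ℂ)) := by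
  have h1 : ell (MvPolynomial.monomial e 1) = ((e (yv 0)).factorial : ℂ) * ((e (yv 1)).factorial : ℂ) := by
    have := (MvPolynomial.basisMonomials (Fin 4) ℂ).constr_basis ℂ
      (fun e => ((e (yv 0)).factorial : ℂ) * ((e (yv 1)).factorial : ℂ)) e
    rw [MvPolynomial.coe_basisMonomials] at this
    exact this
  rw [mono_smul, map_smul, h1, smul_eq_mul]

lemma ell_pd_x (i : Fin 2) (e : Fin 4 →₀ ℕ) (k : ℂ) :
    ell (pd (xin i) (MvPolynomial.monomial e k)) = e (xin i) * ell (MvPolynomial.monomial e k) := by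
  rw [pd_monomial, ell_monomial, ell_monomial]
  have h : ∀ j, (e - Finsupp.single (xin i) 1 : Fin 4 →₀ ℕ) (yv j) = e (yv j) := by
    intro j; simp [Finsupp.single_apply, xin_ne_yv]
  rw [h, h]; ring

lemma ell_pd_y (j : Fin 2) (e : Fin 4 →₀ ℕ) (k : ℂ) (hj : 1 ≤ e (yv j)) :
    ell (pd (yv j) (MvPolynomial.monomial e k)) = ell (MvPolynomial.monomial e k) := by
  rw [pd_monomial, ell_monomial, ell_monomial]
  have h : ∀ t, (e - Finsupp.single (yv j) 1 : Fin 4 →₀ ℕ) t = e t - if yv j = t then 1 else 0 := by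
    intro j; simp [Finsupp.single_apply]
  rw [h, h]
  obtain ⟨t, ht⟩ := Nat.exists_eq_add_of_le' hj
  have hj' : j = 0 ∨ j = 1 := (by decide : ∀ j : Fin 2, j = 0 ∨ j = 1) j
  have n01 : yv 0 ≠ yv 1 := by decide
  rcases hj' with rfl | rfl
  · simp [ht, n01, Nat.factorial_succ]; ring
  · simp [ht, n01.symm, Nat.factorial_succ]; ring

def phi : MEx →ₗ[ℂ] Ex := (TensorProduct.rid ℂ Ex).toLinearMap ∘ₗ TensorProduct.map theta.toLinearMap ell

lemma phi_tmul (ω : Ex) (P : P4) : phi (ω ⊗ₜ P) = ell P • theta ω := by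
  simp [phi]

lemma phi_nabla {a b m n : ℤ} (hn : max a b ≤ n) {z : MEx} (hz : z ∈ GA a b m (n + 1)) :
    phi (nabla z) = 0 := by
  have := GA_le_Fil 0 _ _ _ _ hz
  clear hz
  unfold Fil at this
  induction this using Submodule.span_induction with
  | zero => simp
  | add x y _ _ hx hy => rw [map_add, map_add, hx, hy, add_zero]
  | smul k x _ hx => rw [map_smul, map_smul, hx, smul_zero]
  | mem z hz =>
    obtain ⟨ω, e, hω, h1, h2, h3, rfl⟩ := hz
    have h01 : (0 : Fin 2) ≠ 1 := by decide
    by_cases n0 : dg ![a, b] e 0 < 0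
    · rw [lam_neg hω 0 n0]; simp
    by_cases n1 : dg ![a, b] e 1 < 0
    · rw [lam_neg hω 1 n1]; simp
    simp [dg] at n0 n1
    have y0 : 1 ≤ e (yv 0) := by omega
    have y1 : 1 ≤ e (yv 1) := by omega
    have key : ∀ i j, 1 ≤ e (yv j) → ell (pd (xin i) (pd (yv j) (MvPolynomial.monomial e 1))) =
        e (xin i) * ell (MvPolynomial.monomial e 1) := by
      intro i j hj
      rw [← ell_pd_y j _ _ hj, pd_monomial (yv j), ell_pd_x]
      simp [Finsupp.single_apply, (xin_ne_yv _ _).symm]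
    rw [nabla_tmul h01]
    simp only [map_add, phi_tmul, key _ _ y0, key _ _ y1, map_mul, theta_F0, theta_F1, neg_mul, smul_neg]
    abel

lemma Fil0_tmul {a b n : ℤ} {z : MEx} (hz : z ∈ Fil 0 0 ![a, b] 0 n) :
    ∃ ω ∈ lam ![0, a + b - n], ∃ e : Fin 4 →₀ ℕ, z = ω ⊗ₜ MvPolynomial.monomial e 1 := by
  by_cases ha : 0 ≤ a ∧ a ≤ n
  · let e : Fin 4 →₀ ℕ := Finsupp.single (yv 0) a.toNat + Finsupp.single (yv 1) (n - a).toNat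
    suffices ∃ ω ∈ lam ![0, a + b - n], z = ω ⊗ₜ MvPolynomial.monomial e 1 by
      obtain ⟨ω, h, h'⟩ := this
      exact ⟨ω, h, e, h'⟩
    unfold Fil at hz
    induction hz using Submodule.span_induction with
    | zero => exact ⟨0, zero_mem _, by simp⟩
    | add x y _ _ hx hy =>
      obtain ⟨ω, h, rfl⟩ := hx
      obtain ⟨ω', h', rfl⟩ := hy
      exact ⟨ω + ω', add_mem h h', by rw [TensorProduct.add_tmul]⟩
    | smul k x _ hx =>
      obtain ⟨ω, h, rfl⟩ := hx
      exact ⟨k • ω, Submodule.smul_mem _ _ h, by rw [← TensorProduct.smul_tmul']⟩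
    | mem z hz =>
      obtain ⟨ω, e', hω, h1, h2, h3, rfl⟩ := hz
      by_cases n0 : dg ![a, b] e' 0 < 0
      · rw [lam_neg hω 0 n0]; exact ⟨0, zero_mem _, by simp⟩
      simp [dg] at n0 h3
      refine ⟨ω, ?_, ?_⟩
      · convert hω using 2
        ext j; fin_cases j <;> simp [dg] <;> omega
      · have : e' = e := by
          ext t
          have ht : t = xin 0 ∨ t = xin 1 ∨ t = yv 0 ∨ t = yv 1 := by revert t; decide
          rcases ht with rfl | rfl | rfl | rfl <;> simp [e, xin, yv] at * <;> omega
        rw [this]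
  · refine ⟨0, zero_mem _, 0, ?_⟩
    have h0 : Fil 0 0 ![a, b] 0 n = ⊥ := by
      rw [eq_bot_iff]
      refine Submodule.span_le.2 ?_
      rintro z ⟨ω, e, hω, h1, h2, h3, rfl⟩
      by_cases n0 : dg ![a, b] e 0 < 0
      · rw [lam_neg hω 0 n0]; simp
      exfalso
      simp [dg] at n0 h3
      omega
    rw [h0] at hz
    rw [(Submodule.mem_bot ℂ).1 hz]; simp

lemma phi_ker {a b n : ℤ} (hn : max a b ≤ n) {z : MEx} (hz : z ∈ GA a b 0 n) (h : phi z = 0) :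
    z ∈ Submodule.map nabla (GA a b (0 + 1) (n + 1)) := by
  obtain ⟨u, hu, v, hv, rfl⟩ := Submodule.mem_sup.1 (zero_red 0 hz)
  obtain ⟨w, hw, rfl⟩ := hu
  obtain ⟨ω, hω, e, rfl⟩ := Fil0_tmul hv
  rw [map_add, phi_nabla hn hw, zero_add, phi_tmul, theta_id hω (by simp), ell_monomial] at h
  have h0 : ω = 0 := by
    rcases smul_eq_zero.1 h with h | h
    · exfalso
      have h1 : ((e (yv 0)).factorial : ℂ) ≠ 0 := Nat.cast_ne_zero.2 (Nat.factorial_ne_zero _)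
      have h2 : ((e (yv 1)).factorial : ℂ) ≠ 0 := Nat.cast_ne_zero.2 (Nat.factorial_ne_zero _)
      simp [h1, h2] at h
    · exact h
  rw [h0, TensorProduct.zero_tmul, add_zero]
  exact Submodule.mem_map_of_mem hw

lemma phi_map {a b n : ℤ} (hn : max a b ≤ n) : Submodule.map phi (GA a b 0 n) = lam ![0, a + b - n] := by
  apply le_antisymm
  · rw [Submodule.map_le_iff_le_comap]
    refine (GA_le_Fil 0 _ _ _ _).trans (Submodule.span_le.2 ?_)
    rintro z ⟨ω, e, hω, h1, h2, h3, rfl⟩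
    rw [SetLike.mem_coe, Submodule.mem_comap]
    rw [phi_tmul]
    refine Submodule.smul_mem _ _ ?_
    have := theta_mem hω
    convert this using 3
    simp [dg]; 
    rw [← h2]; ring_nf
  · intro ω hω
    by_cases ha : 0 ≤ a
    · let e : Fin 4 →₀ ℕ := Finsupp.single (yv 0) a.toNat + Finsupp.single (yv 1) (n - a).toNat
      have hmem : ω ⊗ₜ[ℂ] (MvPolynomial.monomial e 1 : P4) ∈ GA a b 0 n := by
        apply Fil_le_GA 0 0
        have hd : ![0, a + b - n] = dg ![a, b] e := by
          ext j; fin_cases j <;> simp [dg, e, yv] <;> omega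
        refine mem_Fil hω hd ?_ ?_ ?_ _
        · simp [e, xin, yv]
        · simp [e, yv]; omega
        · rw [← hd]; simp
      have h1 : ((e (yv 0)).factorial : ℂ) ≠ 0 := Nat.cast_ne_zero.2 (Nat.factorial_ne_zero _)
      have h2 : ((e (yv 1)).factorial : ℂ) ≠ 0 := Nat.cast_ne_zero.2 (Nat.factorial_ne_zero _)
      have h3 := Submodule.mem_map_of_mem (f := phi) hmem
      rw [phi_tmul, theta_id hω (by simp), ell_monomial] at h3
      exact (Submodule.smul_mem_iff _ (by simp [h1, h2])).1 h3
    · rw [lam_neg hω 1 (by simp; omega)]; exact zero_mem _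

lemma lam_span (q : ℕ) (S : Set Ex) (h : ∀ l : List (Fin 2), l.length = q → (l.map (fun i : Fin 2 => f ⟨i.1 + 2, by have := i.2; omega⟩)).prod ∈ Submodule.span ℂ S)
    (h' : S ⊆ lam ![0, (q : ℤ)]) : Submodule.span ℂ S = lam ![0, (q : ℤ)] := by
  apply le_antisymm (Submodule.span_le.2 h')
  refine Submodule.span_le.2 ?_
  rintro x ⟨lp, lm, h1, h2, rfl⟩
  have : lp = [] := by simpa using h1
  subst this
  simpa using h lm (by simpa using h2)

lemma one_mem_lam : (1 : Ex) ∈ lam 0 := Submodule.subset_span ⟨[], [], by simp, by simp, by simp⟩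

lemma lam_basis (q : ℤ) : ∃ v : Fin (zbinom q) → Ex, LinearIndependent ℂ v ∧
    Submodule.span ℂ (Set.range v) = lam ![0, q] := by
  have F1 : ∀ i, FF 1 i ∈ lam ![0, 1] := by
    intro i
    have := lam_mul one_mem_lam 1 i
    rw [mul_one] at this
    convert this using 2
    ext k; fin_cases k <;> simp
  have hc : ∀ i k, ct 1 i (FF 1 k) = if i = k then 1 else 0 := by
    intro i k
    have := ct_FF_mul 1 i 1 k 1
    rw [mul_one, ct_one, mul_zero, sub_zero] at this
    simpa using this
  have triv : zbinom q = 0 → lam ![0, q] = ⊥ → ∃ v : Fin (zbinom q) → Ex, LinearIndependent ℂ v ∧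
    Submodule.span ℂ (Set.range v) = lam ![0, q] := by
    intro h h'
    rw [h, h']
    exact ⟨Fin.elim0, linearIndependent_empty_type, by simp⟩
  by_cases h0 : q < 0
  · refine triv (by simp [zbinom, h0]) (by rw [eq_bot_iff]; intro x hx; exact lam_neg hx 1 (by simpa using h0))
  by_cases h3 : 3 ≤ q
  · refine triv ?_ (by rw [eq_bot_iff]; intro x hx; exact lam_big hx 1 (by simpa using h3))
    simp only [zbinom, not_lt.1 h0, if_true]
    exact Nat.choose_eq_zero_of_lt (by omega)
  have : q = 0 ∨ q = 1 ∨ q = 2 := by omega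
  rcases this with rfl | rfl | rfl
  · rw [show zbinom 0 = 1 by simp [zbinom]]
    refine ⟨fun _ => 1, linearIndependent_unique_iff.2 one_ne_zero, ?_⟩
    refine lam_span 0 _ ?_ ?_
    · intro l hl
      rw [List.length_eq_zero_iff.1 hl]
      exact Submodule.subset_span ⟨0, rfl⟩
    · rintro x ⟨_, rfl⟩
      have e : (![0, ((0 : ℕ) : ℤ)] : Fin 2 → ℤ) = 0 := by
        ext k; fin_cases k <;> simp
      rw [e]; exact one_mem_lam
  · rw [show zbinom 1 = 2 by simp [zbinom]]
    refine ⟨FF 1, ?_, ?_⟩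
    · rw [Fintype.linearIndependent_iff]
      intro g hg i
      have h1 := congrArg (ct 1 i) hg
      rw [map_sum] at h1
      simpa [hc] using h1
    refine lam_span 1 _ ?_ ?_
    · intro l hl
      obtain ⟨i, rfl⟩ := List.length_eq_one_iff.1 hl
      refine Submodule.subset_span ⟨i, ?_⟩
      simp [FF, fidx]
    · rintro x ⟨i, rfl⟩
      exact F1 i
  · rw [show zbinom 2 = 1 by simp [zbinom]]
    have hne : FF 1 0 * FF 1 1 ≠ 0 := by
      intro h
      have h1 := ct_FF_mul 1 0 1 0 (FF 1 1)
      rw [h, hc] at h1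
      simp at h1
      have h2 := hc 1 1
      rw [← h1, map_zero] at h2
      simp at h2
    refine ⟨fun _ => FF 1 0 * FF 1 1, linearIndependent_unique_iff.2 hne, ?_⟩
    refine lam_span 2 _ ?_ ?_
    · intro l hl
      obtain ⟨i, j, rfl⟩ := List.length_eq_two.1 hl
      have hm : FF 1 0 * FF 1 1 ∈ Submodule.span ℂ (Set.range fun _ : Fin 1 => FF 1 0 * FF 1 1) :=
        Submodule.subset_span ⟨0, rfl⟩
      have e : (List.map (fun i : Fin 2 => f ⟨i.1 + 2, by have := i.2; omega⟩) [i, j]).prod = FF 1 i * (FF 1 j * 1) := by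
        simp [FF, fidx]
      rw [e]
      fin_cases i <;> fin_cases j <;> simp only [Fin.zero_eta, Fin.mk_one]
      · rw [FF_sq]; exact zero_mem _
      · rw [mul_one]; exact hm
      · rw [FF_anti, mul_one]; exact neg_mem hm
      · rw [FF_sq]; exact zero_mem _
    · rintro x ⟨_, rfl⟩
      have := lam_mul (F1 1) 1 0
      have e : (![0, ((2 : ℕ) : ℤ)] : Fin 2 → ℤ) = ![0, 1] + sg 1 := by
        ext k; fin_cases k <;> simp
      rw [e]; exact this

/-- for integers `a, b` with `a > 2` or `b > 2` and `k = max a b`: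
`H^{m,n}(G_A(a,b)) = 0` whenever `m > 0`, or `m = 0` and `n < k`; and for `m = 0`,
`n ≥ k`, `H^{0,n}(G_A(a,b))` is a `ℂ`-vector space of dimension `binom(2, a+b−n)`. -/
theorem homology_GA (a b m n : ℤ) (hab : 2 < a ∨ 2 < b) :
    (0 < m →
      GA a b m n ⊓ LinearMap.ker nabla ≤ Submodule.map nabla (GA a b (m + 1) (n + 1))) ∧
    (m = 0 → n < max a b →
      GA a b m n ⊓ LinearMap.ker nabla ≤ Submodule.map nabla (GA a b (m + 1) (n + 1))) ∧
    (m = 0 → max a b ≤ n →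
      Nonempty ((↥(GA a b m n ⊓ LinearMap.ker nabla) ⧸
          (Submodule.comap (GA a b m n ⊓ LinearMap.ker nabla).subtype
            (Submodule.map nabla (GA a b (m + 1) (n + 1))))) ≃ₗ[ℂ]
        (Fin (zbinom (a + b - n)) → ℂ))) := by
  refine ⟨fun hm => ?_, ?_, ?_⟩
  · rcases hab with h | h
    · exact exact_pos 0 (by simpa using h) hm
    · exact exact_pos 1 (by simpa using h) hm
  · rintro rfl hn
    refine inf_le_left.trans ?_
    rcases lt_max_iff.1 hn with h | h
    · exact exact_zero 0 (by simpa using h)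
    · exact exact_zero 1 (by simpa using h)
  · rintro rfl hn
    obtain ⟨v, hv, hs⟩ := lam_basis (a + b - n)
    have hK : GA a b 0 n ⊓ LinearMap.ker nabla = GA a b 0 n :=
      inf_eq_left.2 fun z hz => nabla_m0 hz
    let g : ↥(GA a b 0 n ⊓ LinearMap.ker nabla) →ₗ[ℂ] Ex :=
      phi ∘ₗ (GA a b 0 n ⊓ LinearMap.ker nabla).subtype
    have hker : Submodule.comap (GA a b 0 n ⊓ LinearMap.ker nabla).subtype
            (Submodule.map nabla (GA a b (0 + 1) (n + 1))) = LinearMap.ker g := by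
      ext z
      rw [Submodule.mem_comap, LinearMap.mem_ker]
      constructor
      · rintro ⟨w, hw, hwz⟩
        change phi ((GA a b 0 n ⊓ LinearMap.ker nabla).subtype z) = 0
        rw [← hwz]
        exact phi_nabla hn hw
      · intro h
        exact phi_ker hn z.2.1 h
    have hrange : LinearMap.range g = Submodule.span ℂ (Set.range v) := by
      rw [hs, ← phi_map hn, LinearMap.range_comp, Submodule.range_subtype, hK]
    exact ⟨(Submodule.quotEquivOfEq _ _ hker).trans (g.quotKerEquivRange.trans
      ((LinearEquiv.ofEq _ _ hrange).trans (Module.Basis.span hv).equivFun))⟩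

end
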